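/- Closed formula (2.12) for E = E₁ − E₂: let ζ = (ζ₁,ζ₂) ∈ ℂ² and w ∈ ℂ with w ≠ 0 and w² = ζ₁² + ζ₂², and set E₂(x,ζ) = −(i·ζ_vec/w)·E₁(x,ζ) and E(x,ζ) = E₁(x,ζ) − E₂(x,ζ). Then for all x ∈ ℝ³: E(x,ζ) = e^{i(x₁ζ₁ + x₂ζ₂) − x₀·w} · ( e₀ + (i·ζ_vec)/w ), where the first factor is an ordinary complex exponential acting as a scalar. In particular the scalar (e₀-) part of E(x,ζ) equals e^{i(x₁ζ₁ + x₂ζ₂) − x₀·w}. -/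

import Mathlib

open scoped Quaternion

noncomputable section

/-- The basis element `e₁` of the complex Clifford algebra `ℂ₍₂₎ = ℍ[ℂ]`. -/
def e1 : ℍ[ℂ] := ⟨0, 1, 0, 0⟩

/-- The basis element `e₂` of the complex Clifford algebra `ℂ₍₂₎ = ℍ[ℂ]`. -/
def e2 : ℍ[ℂ] := ⟨0, 0, 1, 0⟩

/-- `ζ_vec = ζ₁ e₁ + ζ₂ e₂`. -/
def zvec (ζ : ℂ × ℂ) : ℍ[ℂ] := ⟨0, ζ.1, ζ.2, 0⟩

/-- The exponential power series `Σ_{k≥0} (1/k!) Aᵏ` in `ℂ₍₂₎`, computed componentwise. -/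
def qexp (A : ℍ[ℂ]) : ℍ[ℂ] :=
  ⟨∑' k : ℕ, (k.factorial : ℂ)⁻¹ * (A ^ k).re,
   ∑' k : ℕ, (k.factorial : ℂ)⁻¹ * (A ^ k).imI,
   ∑' k : ℕ, (k.factorial : ℂ)⁻¹ * (A ^ k).imJ,
   ∑' k : ℕ, (k.factorial : ℂ)⁻¹ * (A ^ k).imK⟩

/-- `E₁(x,ζ) = exp(i(x₁ζ₁ + x₂ζ₂)e₀ − i x₀ ζ_vec)`. -/
def E1 (x : Fin 3 → ℝ) (ζ : ℂ × ℂ) : ℍ[ℂ] :=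
  qexp ((Complex.I * ((x 1 : ℂ) * ζ.1 + (x 2 : ℂ) * ζ.2)) • (1 : ℍ[ℂ])
    - (Complex.I * (x 0 : ℂ)) • zvec ζ)

/-- Componentwise partial derivative of a `ℂ₍₂₎`-valued function in the `j`-th direction. -/
def pdQ (j : Fin 3) (f : (Fin 3 → ℝ) → ℍ[ℂ]) (x : Fin 3 → ℝ) : ℍ[ℂ] :=
  ⟨fderiv ℝ (fun y => (f y).re) x (Pi.single j 1),
   fderiv ℝ (fun y => (f y).imI) x (Pi.single j 1),
   fderiv ℝ (fun y => (f y).imJ) x (Pi.single j 1),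
   fderiv ℝ (fun y => (f y).imK) x (Pi.single j 1)⟩

/-- Componentwise differentiability of a `ℂ₍₂₎`-valued function. -/
def QDiffAt (f : (Fin 3 → ℝ) → ℍ[ℂ]) (x : Fin 3 → ℝ) : Prop :=
  DifferentiableAt ℝ (fun y => (f y).re) x ∧ DifferentiableAt ℝ (fun y => (f y).imI) x ∧
  DifferentiableAt ℝ (fun y => (f y).imJ) x ∧ DifferentiableAt ℝ (fun y => (f y).imK) x

/-- The left Cauchy–Riemann operator `D⁽ˡ⁾f = ∂₀f + e₁ ∂₁f + e₂ ∂₂f`. -/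
def Dl (f : (Fin 3 → ℝ) → ℍ[ℂ]) (x : Fin 3 → ℝ) : ℍ[ℂ] :=
  pdQ 0 f x + e1 * pdQ 1 f x + e2 * pdQ 2 f x

/-- The right Cauchy–Riemann operator `D⁽ʳ⁾f = ∂₀f + (∂₁f) e₁ + (∂₂f) e₂`. -/
def Dr (f : (Fin 3 → ℝ) → ℍ[ℂ]) (x : Fin 3 → ℝ) : ℍ[ℂ] :=
  pdQ 0 f x + pdQ 1 f x * e1 + pdQ 2 f x * e2

/-- The conjugate left Cauchy–Riemann operator `D̄⁽ˡ⁾f = ∂₀f − e₁ ∂₁f − e₂ ∂₂f`. -/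
def Dbar (f : (Fin 3 → ℝ) → ℍ[ℂ]) (x : Fin 3 → ℝ) : ℍ[ℂ] :=
  pdQ 0 f x - e1 * pdQ 1 f x - e2 * pdQ 2 f x

/-- An involution `u` splits `a + b u` into its eigenvalues `a + b` and `a - b`. -/
theorem smul_one_add_smul_pow_of_mul_self_eq_one {R : Type*} [Ring R] [Algebra ℂ R] {u : R}
    (hu : u * u = 1) (a b : ℂ) (k : ℕ) :
    (a • (1 : R) + b • u) ^ k =
      ((a + b) ^ k / 2) • (1 + u) + ((a - b) ^ k / 2) • (1 - u) := by
  induction k with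
  | zero => simp only [pow_zero]; module
  | succ k ih =>
    rw [pow_succ, ih]
    simp only [add_mul, sub_mul, mul_add, smul_mul_assoc, mul_smul_comm, smul_add,
      smul_sub, one_mul, mul_one, hu]
    module

theorem hasSum_exp_mul (z c : ℂ) :
    HasSum (fun k : ℕ => (k.factorial : ℂ)⁻¹ * (z ^ k * c)) (Complex.exp z * c) := by
  have h := (NormedSpace.expSeries_div_hasSum_exp z).mul_right c
  rw [← Complex.exp_eq_exp_ℂ] at h
  exact h.congr_fun fun k => by ring

theorem qexp_eq_of_pow_eq {A P Q : ℍ[ℂ]} {s t : ℂ}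
    (h : ∀ k : ℕ, A ^ k = s ^ k • P + t ^ k • Q) :
    qexp A = Complex.exp s • P + Complex.exp t • Q := by
  have key (p q : ℂ) : ∑' k : ℕ, (k.factorial : ℂ)⁻¹ * (s ^ k * p + t ^ k * q) =
      Complex.exp s * p + Complex.exp t * q := by
    simp only [mul_add]
    exact ((hasSum_exp_mul s p).add (hasSum_exp_mul t q)).tsum_eq
  ext <;> simp [qexp, h, key]

theorem qexp_smul_one_add_smul {u : ℍ[ℂ]} (hu : u * u = 1) (a b : ℂ) :
    qexp (a • (1 : ℍ[ℂ]) + b • u) =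
      (Complex.exp (a + b) / 2) • (1 + u) + (Complex.exp (a - b) / 2) • (1 - u) := by
  rw [qexp_eq_of_pow_eq (s := a + b) (t := a - b)
    (P := (2⁻¹ : ℂ) • (1 + u)) (Q := (2⁻¹ : ℂ) • (1 - u))]
  · simp only [smul_smul, div_eq_mul_inv]
  · intro k
    simp only [smul_one_add_smul_pow_of_mul_self_eq_one hu, smul_smul, div_eq_mul_inv]

theorem smul_mul_self_eq_one {R : Type*} [Ring R] [Algebra ℂ R] {z : R} {c r : ℂ}
    (hz : z * z = r • (1 : R)) (hc : c * c * r = 1) : (c • z) * (c • z) = 1 := by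
  rw [smul_mul_smul_comm, hz, smul_smul, hc, one_smul]

theorem sub_neg_smul_mul_of_eq {R : Type*} [Ring R] [Algebra ℂ R] {z q : R} {c s t : ℂ}
    (hz : (c • z) * (c • z) = 1)
    (hq : q = (s / 2) • (1 + c • z) + (t / 2) • (1 - c • z)) :
    q - (-c) • (z * q) = s • (1 + c • z) := by
  rw [neg_smul, sub_neg_eq_add, ← smul_mul_assoc, hq]
  generalize c • z = u at hz ⊢
  simp only [mul_add, mul_sub, mul_smul_comm, mul_one, hz]
  module

@[simp] theorem re_zvec (ζ : ℂ × ℂ) : (zvec ζ).re = 0 := rfl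

@[simp] theorem imI_zvec (ζ : ℂ × ℂ) : (zvec ζ).imI = ζ.1 := rfl

@[simp] theorem imJ_zvec (ζ : ℂ × ℂ) : (zvec ζ).imJ = ζ.2 := rfl

@[simp] theorem imK_zvec (ζ : ℂ × ℂ) : (zvec ζ).imK = 0 := rfl

theorem zvec_mul_self (ζ : ℂ × ℂ) : zvec ζ * zvec ζ = (-(ζ.1 ^ 2 + ζ.2 ^ 2)) • (1 : ℍ[ℂ]) := by
  ext <;> simp <;> ring

theorem smul_zvec_mul_self {ζ : ℂ × ℂ} {w : ℂ} (hw : w ≠ 0) (hw2 : w ^ 2 = ζ.1 ^ 2 + ζ.2 ^ 2) :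
    ((Complex.I / w) • zvec ζ) * ((Complex.I / w) • zvec ζ) = 1 := by
  refine smul_mul_self_eq_one (zvec_mul_self ζ) ?_
  rw [← hw2]
  field_simp
  simp

theorem E1_eq {ζ : ℂ × ℂ} {w : ℂ} (hw : w ≠ 0) (hw2 : w ^ 2 = ζ.1 ^ 2 + ζ.2 ^ 2)
    (x : Fin 3 → ℝ) :
    E1 x ζ =
      (Complex.exp (Complex.I * ((x 1 : ℂ) * ζ.1 + (x 2 : ℂ) * ζ.2) - (x 0 : ℂ) * w) / 2) •
          (1 + (Complex.I / w) • zvec ζ) +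
        (Complex.exp (Complex.I * ((x 1 : ℂ) * ζ.1 + (x 2 : ℂ) * ζ.2) + (x 0 : ℂ) * w) / 2) •
          (1 - (Complex.I / w) • zvec ζ) := by
  have h := qexp_smul_one_add_smul (smul_zvec_mul_self hw hw2)
    (Complex.I * ((x 1 : ℂ) * ζ.1 + (x 2 : ℂ) * ζ.2)) (-((x 0 : ℂ) * w))
  have hc : -((x 0 : ℂ) * w) * (Complex.I / w) = -(Complex.I * (x 0 : ℂ)) := by
    field_simp
  have hneg : -(Complex.I * (x 0 : ℂ)) • zvec ζ = -((Complex.I * (x 0 : ℂ)) • zvec ζ) :=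
    neg_smul (Complex.I * (x 0 : ℂ)) (zvec ζ)
  rwa [smul_smul, hc, hneg, ← sub_eq_add_neg, ← sub_eq_add_neg, sub_neg_eq_add] at h

/-- Closed formula (2.12) for `E = E₁ − E₂`: if `w ≠ 0`, `w² = ζ₁² + ζ₂²` and
`E₂(x,ζ) = −(i ζ_vec / w) E₁(x,ζ)`, then
`E(x,ζ) = e^{i(x₁ζ₁ + x₂ζ₂) − x₀w} (e₀ + i ζ_vec / w)`; in particular the scalar part of
`E(x,ζ)` is `e^{i(x₁ζ₁ + x₂ζ₂) − x₀w}`. -/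
theorem E_closed_formula (ζ : ℂ × ℂ) (w : ℂ) (hw : w ≠ 0) (hw2 : w ^ 2 = ζ.1 ^ 2 + ζ.2 ^ 2)
    (x : Fin 3 → ℝ) :
    E1 x ζ - (-(Complex.I / w)) • (zvec ζ * E1 x ζ) =
        Complex.exp (Complex.I * ((x 1 : ℂ) * ζ.1 + (x 2 : ℂ) * ζ.2) - (x 0 : ℂ) * w) •
          ((1 : ℍ[ℂ]) + (Complex.I / w) • zvec ζ) ∧
      (E1 x ζ - (-(Complex.I / w)) • (zvec ζ * E1 x ζ)).re =
        Complex.exp (Complex.I * ((x 1 : ℂ) * ζ.1 + (x 2 : ℂ) * ζ.2) - (x 0 : ℂ) * w) := by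
  have main : E1 x ζ - (-(Complex.I / w)) • (zvec ζ * E1 x ζ) =
      Complex.exp (Complex.I * ((x 1 : ℂ) * ζ.1 + (x 2 : ℂ) * ζ.2) - (x 0 : ℂ) * w) •
        ((1 : ℍ[ℂ]) + (Complex.I / w) • zvec ζ) :=
    sub_neg_smul_mul_of_eq (smul_zvec_mul_self hw hw2) (E1_eq hw hw2 x)
  refine ⟨main, ?_⟩
  rw [main]
  simp
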